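/- arXiv:math/9909011 — 2 statements merged into one kernel-verified Lean document; each statement's English description precedes it below -/
import Mathlib

section
/- For y ≥ 2 define I(y) = 2 y · log( y/2 + √(y²/4 − 1) ) − 2 √(y² − 4) (so that log(y/2 + √(y²/4 − 1)) = arcosh(y/2)). Then there exist constants C > 0 and δ ∈ (0, 1] such that for all x ∈ (0, δ], I(2 + x) ≥ C x^{3/2}. -/
/-- Lower bound near the edge for the large-deviation rate function
`I(y) = 2y·arcosh(y/2) - 2√(y² - 4)` (for `y ≥ 2`, with `arcosh(y/2) = log(y/2 + √(y²/4 - 1))`):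
there are `C > 0` and `δ ∈ (0, 1]` with `I(2 + x) ≥ C x^{3/2}` for all `x ∈ (0, δ]`. -/
theorem stmt5 (I : ℝ → ℝ)
    (hI : ∀ y : ℝ, 2 ≤ y →
      I y = 2 * y * Real.log (y / 2 + Real.sqrt (y ^ 2 / 4 - 1)) - 2 * Real.sqrt (y ^ 2 - 4)) :
    ∃ C : ℝ, 0 < C ∧ ∃ δ : ℝ, δ ∈ Set.Ioc (0 : ℝ) 1 ∧
      ∀ x ∈ Set.Ioc (0 : ℝ) δ, C * x ^ ((3 : ℝ) / 2) ≤ I (2 + x) := by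
  refine ⟨1 / 2, by norm_num, 1, by simp, ?_⟩
  rintro x ⟨hx0, hx1⟩
  obtain ⟨r, hr, rfl⟩ : ∃ r : ℝ, 0 < r ∧ r ^ 2 = x :=
    ⟨√x, Real.sqrt_pos.2 hx0, Real.sq_sqrt hx0.le⟩
  obtain ⟨v, hv, hvr⟩ : ∃ v : ℝ, 0 < v ∧ v ^ 2 = 4 + r ^ 2 :=
    ⟨√(4 + r ^ 2), by positivity, Real.sq_sqrt (by positivity)⟩
  have hrv : r < v := by nlinarith
  have hv4 : v ≤ 4 := by nlinarith
  have hpow : (r ^ 2) ^ ((3 : ℝ) / 2) = r ^ 3 := by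
    rw [← Real.rpow_natCast r 2, ← Real.rpow_mul hr.le, ← Real.rpow_natCast r 3]
    norm_num
  have hsqrt₁ : √((2 + r ^ 2) ^ 2 / 4 - 1) = r * v / 2 := by
    rw [show (2 + r ^ 2) ^ 2 / 4 - 1 = (r * v / 2) ^ 2 by rw [div_pow, mul_pow, hvr]; ring]
    exact Real.sqrt_sq (by positivity)
  have hsqrt₂ : √((2 + r ^ 2) ^ 2 - 4) = r * v := by
    rw [show (2 + r ^ 2) ^ 2 - 4 = (r * v) ^ 2 by rw [mul_pow, hvr]; ring]
    exact Real.sqrt_sq (by positivity)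
  have hlog : 2 * (r / v) ≤ Real.log ((2 + r ^ 2) / 2 + r * v / 2) := by
    have h := Real.sum_range_le_log_div (x := r / v) (by positivity) ((div_lt_one hv).2 hrv) 1
    have harg : (1 + r / v) / (1 - r / v) = (2 + r ^ 2) / 2 + r * v / 2 := by
      have hsub : v - r ≠ 0 := (sub_pos.2 hrv).ne'
      have hquot : (1 + r / v) / (1 - r / v) = (v + r) / (v - r) := by
        field_simp
      rw [hquot, div_eq_iff hsub]
      linear_combination (-r / 2) * hvr
    rw [harg] at h
    norm_num at h
    linarith
  rw [hpow, hI _ (by nlinarith), hsqrt₁, hsqrt₂]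
  have hmul := mul_le_mul_of_nonneg_left hlog (show 0 ≤ 2 * (2 + r ^ 2) by positivity)
  have hmain : 2 * (2 + r ^ 2) * (2 * (r / v)) = 2 * (r * v) + 2 * r ^ 3 / v := by
    field_simp
    linear_combination -hvr
  have hcube : 1 / 2 * r ^ 3 ≤ 2 * r ^ 3 / v := by
    rw [le_div_iff₀ hv]
    nlinarith [pow_pos hr 3]
  linarith
end

section
/- Let V₀ : ℝ → ℝ be Lipschitz continuous with V₀(0) = 0, and assume the asymptotic slopes v₀(−∞) = lim_{x→−∞} V₀(x)/x and v₀(+∞) = lim_{x→+∞} V₀(x)/x exist. Define V_∞(y) = v₀(−∞)·y for y < 0, V_∞(0) = 0, and V_∞(y) = v₀(+∞)·y for y > 0. Then for every b > 0 and t > 0, liminf_{s→∞} inf_{|y| ≤ b} { s^{-1} V₀(s y) + y²/(4t) } ≥ inf_{y∈ℝ} { V_∞(y) + y²/(4t) }. -/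
open Filter

/-- A Lipschitz function vanishing at `0` lies above its asymptotic profile up to an arbitrarily
small linear error and a constant. -/
theorem exists_asymptotic_profile_sub_le {V : ℝ → ℝ} {L : NNReal} (hLip : LipschitzWith L V)
    (h0 : V 0 = 0) {vm vp : ℝ}
    (hm : Tendsto (fun x : ℝ => V x / x) atBot (nhds vm))
    (hp : Tendsto (fun x : ℝ => V x / x) atTop (nhds vp)) {δ : ℝ} (hδ : 0 < δ) :
    ∃ C : ℝ, 0 ≤ C ∧ ∀ x : ℝ, (if x < 0 then vm * x else vp * x) - δ * |x| - C ≤ V x := by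
  obtain ⟨M₁, hM₁⟩ := eventually_atTop.1 (hp.eventually (lt_mem_nhds (sub_lt_self vp hδ)))
  obtain ⟨M₂, hM₂⟩ := eventually_atBot.1 (hm.eventually (gt_mem_nhds (lt_add_of_pos_right vm hδ)))
  set M : ℝ := |M₁| + |M₂| + 1 with hM
  have hMpos : 0 < M := by positivity
  have hM1 : M₁ ≤ M := by linarith [le_abs_self M₁, abs_nonneg M₂]
  have hM2 : -M ≤ M₂ := by linarith [neg_abs_le M₂, abs_nonneg M₁]
  have hC : 0 ≤ (|vm| + |vp| + L) * M := by positivity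
  refine ⟨(|vm| + |vp| + L) * M, hC, fun x => ?_⟩
  rcases le_or_gt M x with hx | hx
  · have hx0 : 0 < x := hMpos.trans_le hx
    have h := (lt_div_iff₀ hx0).1 (hM₁ x (hM1.trans hx))
    rw [if_neg hx0.not_gt, abs_of_pos hx0]
    nlinarith
  rcases le_or_gt x (-M) with hx' | hx'
  · have hx0 : x < 0 := by linarith
    have h := (div_lt_iff_of_neg hx0).1 (hM₂ x (hx'.trans hM2))
    rw [if_pos hx0, abs_of_neg hx0]
    nlinarith
  · have hxM : |x| ≤ M := abs_le.2 ⟨hx'.le, hx.le⟩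
    have hV : |V x| ≤ L * |x| := by
      simpa [Real.dist_eq, h0] using hLip.dist_le_mul x 0
    have hVM : |V x| ≤ L * M := hV.trans (by gcongr)
    have h1 : vm * x ≤ |vm| * M := by
      calc vm * x ≤ |vm * x| := le_abs_self _
        _ = |vm| * |x| := abs_mul _ _
        _ ≤ |vm| * M := by gcongr
    have h2 : vp * x ≤ |vp| * M := by
      calc vp * x ≤ |vp * x| := le_abs_self _
        _ = |vp| * |x| := abs_mul _ _
        _ ≤ |vp| * M := by gcongr
    have h3 : 0 ≤ |vm| * M := by positivity
    have h4 : 0 ≤ |vp| * M := by positivity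
    have h5 : 0 ≤ δ * |x| := by positivity
    have h6 := neg_abs_le (V x)
    split_ifs <;> linarith

/-- With `V₀`, the asymptotic slopes and the asymptotic profile `V_∞` as
before, for every `b > 0` and `t > 0`,
`liminf_{s→∞} inf_{|y|≤b} { s⁻¹ V₀(s y) + y²/(4t) } ≥ inf_{y ∈ ℝ} { V_∞(y) + y²/(4t) }`. -/
theorem stmt10 (V₀ : ℝ → ℝ) (L : NNReal) (hLip : LipschitzWith L V₀) (h0 : V₀ 0 = 0)
    (vm vp : ℝ)
    (hm : Tendsto (fun x : ℝ => V₀ x / x) atBot (nhds vm))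
    (hp : Tendsto (fun x : ℝ => V₀ x / x) atTop (nhds vp))
    (Vinf : ℝ → ℝ)
    (hVinf : ∀ y : ℝ, Vinf y = if y < 0 then vm * y else vp * y)
    (b t : ℝ) (hb : 0 < b) (ht : 0 < t) :
    (⨅ y : ℝ, (Vinf y + y ^ 2 / (4 * t))) ≤
      Filter.liminf
        (fun s : ℝ => ⨅ y : Set.Icc (-b) b, (V₀ (s * (y : ℝ)) / s + (y : ℝ) ^ 2 / (4 * t)))
        atTop := by
  have : Nonempty (Set.Icc (-b) b) := ⟨⟨0, by linarith, hb.le⟩⟩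
  have hbdd : BddBelow (Set.range fun y : ℝ => Vinf y + y ^ 2 / (4 * t)) := by
    refine ⟨-(vm ^ 2 + vp ^ 2) * t, ?_⟩
    rintro _ ⟨y, rfl⟩
    have key : ∀ v : ℝ, -v ^ 2 * t ≤ v * y + y ^ 2 / (4 * t) := fun v => by
      have h : v * y + y ^ 2 / (4 * t) + v ^ 2 * t = (y + 2 * v * t) ^ 2 / (4 * t) := by
        field_simp
        ring
      have : 0 ≤ (y + 2 * v * t) ^ 2 / (4 * t) := by positivity
      linarith
    have h1 : 0 ≤ vm ^ 2 * t := by positivity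
    have h2 : 0 ≤ vp ^ 2 * t := by positivity
    have h3 := key vm
    have h4 := key vp
    simp only [hVinf]
    split_ifs <;> linarith
  have hle_zero : ∀ᶠ s : ℝ in atTop,
      (⨅ y : Set.Icc (-b) b, (V₀ (s * (y : ℝ)) / s + (y : ℝ) ^ 2 / (4 * t))) ≤ 0 := by
    filter_upwards [eventually_gt_atTop 0] with s hs
    have hbd : BddBelow (Set.range fun y : Set.Icc (-b) b =>
        V₀ (s * (y : ℝ)) / s + (y : ℝ) ^ 2 / (4 * t)) := by
      refine ⟨-(L * b), ?_⟩
      rintro _ ⟨⟨y, hy⟩, rfl⟩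
      have hV : |V₀ (s * y)| ≤ L * |s * y| := by
        simpa [Real.dist_eq, h0] using hLip.dist_le_mul (s * y) 0
      have hyb : |y| ≤ b := abs_le.2 hy
      have hVb : |V₀ (s * y)| ≤ L * b * s := by
        calc |V₀ (s * y)| ≤ L * |s * y| := hV
          _ = L * |y| * s := by rw [abs_mul, abs_of_pos hs]; ring
          _ ≤ L * b * s := by gcongr
      have h1 : -(L * b) ≤ V₀ (s * y) / s := by
        rw [le_div_iff₀ hs]
        linarith [neg_abs_le (V₀ (s * y))]
      have h2 : 0 ≤ y ^ 2 / (4 * t) := by positivity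
      change -(L * b) ≤ V₀ (s * y) / s + y ^ 2 / (4 * t)
      linarith
    refine (ciInf_le hbd ⟨0, by linarith, hb.le⟩).trans ?_
    simp [h0]
  have hcob : IsCoboundedUnder (· ≥ ·) atTop fun s : ℝ =>
      ⨅ y : Set.Icc (-b) b, (V₀ (s * (y : ℝ)) / s + (y : ℝ) ^ 2 / (4 * t)) :=
    IsBoundedUnder.isCoboundedUnder_ge ⟨0, eventually_map.2 hle_zero⟩
  refine le_of_forall_pos_sub_le fun ε hε => le_liminf_of_le hcob ?_
  obtain ⟨C, hC, hV⟩ := exists_asymptotic_profile_sub_le hLip h0 hm hp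
    (show 0 < ε / (2 * b) by positivity)
  filter_upwards [eventually_gt_atTop 0, eventually_ge_atTop (2 * C / ε)] with s hs hsC
  refine le_ciInf fun ⟨y, hy⟩ => ?_
  have hyb : |y| ≤ b := abs_le.2 hy
  have hscale : (if s * y < 0 then vm * (s * y) else vp * (s * y)) = Vinf y * s := by
    simp only [hVinf, mul_neg_iff, hs, hs.not_gt, true_and, false_and, or_false]
    split_ifs <;> ring
  have hδ : ε / (2 * b) * |s * y| ≤ ε / 2 * s := by
    calc ε / (2 * b) * |s * y| = ε / (2 * b) * |y| * s := by
          rw [abs_mul, abs_of_pos hs]; ring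
      _ ≤ ε / (2 * b) * b * s := by gcongr
      _ = ε / 2 * s := by field_simp
  have hCs : 2 * C ≤ s * ε := (div_le_iff₀ hε).1 hsC
  have hmain : Vinf y - ε ≤ V₀ (s * y) / s := by
    have h := hV (s * y)
    rw [hscale] at h
    rw [le_div_iff₀ hs]
    linarith
  have hinf := ciInf_le hbdd y
  change _ ≤ V₀ (s * y) / s + y ^ 2 / (4 * t)
  linarith
end
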